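/- Let G1 and G2 be finite groups such that the independence complexes Σ(G1) and Σ(G2) are isomorphic, or the strong independence complexes Σ̃(G1) and Σ̃(G2) are isomorphic. Then for every positive integer n, the number of elements of order n in G1 equals the number of elements of order n in G2. -/

import Mathlib

/-- A subset `X` of a group is independent if no element of `X` lies in the
subgroup generated by the other elements of `X`. -/
def Independent {G : Type*} [Group G] (X : Set G) : Prop :=
  ∀ x ∈ X, x ∉ Subgroup.closure (X \ {x})

/-- `dgen H` is the least cardinality of a generating set of the subgroup `H`. -/
noncomputable def dgen {G : Type*} [Group G] (H : Subgroup G) : ℕ :=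
  sInf {n : ℕ | ∃ S : Set G, S.Finite ∧ S ⊆ (H : Set G) ∧ Subgroup.closure S = H ∧ S.ncard = n}

/-- A subset `X` of a group is strongly independent if every subgroup `H` containing `X`
satisfies `|X| ≤ d(H)`. -/
def StronglyIndependent {G : Type*} [Group G] (X : Set G) : Prop :=
  ∀ H : Subgroup G, X ⊆ (H : Set G) → X.ncard ≤ dgen H

/-- A group is hamiltonian if it is nonabelian and all of its subgroups are normal. -/
def IsHamiltonian (G : Type*) [Group G] : Prop :=
  (∃ a b : G, a * b ≠ b * a) ∧ ∀ H : Subgroup G, H.Normal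

open Subgroup in
/-- In a finite cyclic subgroup, membership in a cyclic subgroup is divisibility of orders. -/
theorem mem_zpowers_of_orderOf_dvd {G : Type*} [Group G] [Finite G] {c x y : G}
    (hx : x ∈ zpowers c) (hy : y ∈ zpowers c) (h : orderOf x ∣ orderOf y) : x ∈ zpowers y := by
  classical
  have : Fintype (zpowers c) := Fintype.ofFinite _
  set y' : zpowers c := ⟨y, hy⟩
  set x' : zpowers c := ⟨x, hx⟩
  have hy' : orderOf y' = orderOf y := (Subgroup.orderOf_mk y hy)
  have hx' : orderOf x' = orderOf x := (Subgroup.orderOf_mk x hx)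
  have hle := IsCyclic.card_pow_eq_one_le (α := zpowers c) (orderOf_pos y')
  have hsub : Finset.univ.filter (· ∈ zpowers y') ⊆
      Finset.univ.filter (fun b : zpowers c => b ^ orderOf y' = 1) := by
    intro b hb
    simp only [Finset.mem_filter, Finset.mem_univ, true_and] at hb ⊢
    exact orderOf_dvd_iff_pow_eq_one.1 (orderOf_dvd_of_mem_zpowers hb)
  have hcard : (Finset.univ.filter (· ∈ zpowers y')).card = orderOf y' := by
    rw [← Nat.card_zpowers, Nat.card_eq_fintype_card, Fintype.card_subtype]
  have heq := Finset.eq_of_subset_of_card_le hsub (hcard ▸ hle)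
  have hmem : x' ∈ Finset.univ.filter (· ∈ zpowers y') := by
    rw [heq]
    simp only [Finset.mem_filter, Finset.mem_univ, true_and]
    exact orderOf_dvd_iff_pow_eq_one.1 (by rwa [hx', hy'])
  simp only [Finset.mem_filter, Finset.mem_univ, true_and] at hmem
  obtain ⟨k, hk⟩ := mem_zpowers_iff.1 hmem
  exact mem_zpowers_iff.2 ⟨k, by simpa [x', y'] using congrArg Subtype.val hk⟩

open Subgroup in
theorem zpowers_eq_of_mem {G : Type*} [Group G] {x y : G}
    (h₁ : x ∈ zpowers y) (h₂ : y ∈ zpowers x) : zpowers x = zpowers y :=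
  le_antisymm (zpowers_le.2 h₁) (zpowers_le.2 h₂)

open Subgroup in
theorem mem_zpowers_trans {G : Type*} [Group G] {x y z : G}
    (h₁ : x ∈ zpowers y) (h₂ : y ∈ zpowers z) : x ∈ zpowers z :=
  zpowers_le.2 h₂ h₁

open Subgroup in
theorem exists_mem_zpowers_orderOf_eq {G : Type*} [Group G] [Finite G] (c : G) {d : ℕ}
    (h : d ∣ orderOf c) : ∃ x ∈ zpowers c, orderOf x = d :=
  ⟨c ^ (orderOf c / d), npow_mem_zpowers c _, orderOf_pow_orderOf_div (orderOf_pos c).ne' h⟩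

theorem ncard_mem_orderOf_eq_subtype {G : Type*} [Group G] (H : Subgroup G) (n : ℕ) :
    {g | g ∈ H ∧ orderOf g = n}.ncard = {g : H | orderOf g = n}.ncard := by
  rw [← Set.ncard_image_of_injective _ (Subtype.val_injective (p := (· ∈ H)))]
  congr 1
  ext g
  simp [and_comm]

open Subgroup in
theorem ncard_orderOf_eq_of_zpowers {G H : Type*} [Group G] [Group H] {c : G} {d : H}
    (h : orderOf c = orderOf d) (n : ℕ) :
    {g | g ∈ zpowers c ∧ orderOf g = n}.ncard = {g | g ∈ zpowers d ∧ orderOf g = n}.ncard := by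
  have e : zpowers c ≃* zpowers d := mulEquivOfCyclicCardEq (by simpa [Nat.card_zpowers] using h)
  rw [ncard_mem_orderOf_eq_subtype, ncard_mem_orderOf_eq_subtype,
    ← Set.ncard_image_of_injective _ e.injective]
  congr 1
  ext g
  simp only [Set.mem_image, Set.mem_ofPred_eq]
  constructor
  · rintro ⟨x, hx, rfl⟩
    rwa [e.orderOf_eq]
  · intro hg
    exact ⟨e.symm g, by rwa [e.symm.orderOf_eq], by simp⟩

open Subgroup in
theorem ncard_generators_zpowers {G : Type*} [Group G] [Finite G] (c : G) :
    {g | zpowers g = zpowers c}.ncard = (orderOf c).totient := by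
  classical
  have : Fintype (zpowers c) := Fintype.ofFinite _
  rw [← IsCyclic.card_orderOf_eq_totient (α := zpowers c) (d := orderOf c)
    (by rw [← Nat.card_eq_fintype_card, Nat.card_zpowers]), ← Set.ncard_coe_finset,
    ← Set.ncard_image_of_injective _ (Subtype.val_injective (p := (· ∈ zpowers c)))]
  congr 1
  ext g
  simp only [Set.mem_ofPred_eq, Finset.coe_filter, Finset.mem_univ, true_and, Set.mem_image,
    Subtype.exists, Subgroup.orderOf_mk, exists_and_left, exists_prop, exists_eq_right_right]
  constructor
  · intro h
    exact ⟨by rw [← Nat.card_zpowers, h, Nat.card_zpowers], h ▸ mem_zpowers g⟩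
  · rintro ⟨h₁, h₂⟩
    exact zpowers_eq_of_mem h₂
      (mem_zpowers_of_orderOf_dvd (mem_zpowers c) h₂ h₁.symm.dvd)

theorem exists_prime_dvd_ne {n p : ℕ} (hn : n ≠ 0) (hpp : ¬IsPrimePow n) (hp : p.Prime)
    (hpn : p ∣ n) : ∃ q, q.Prime ∧ q ∣ n ∧ q ≠ p := by
  by_contra! hcon
  have h := Nat.eq_prime_pow_of_unique_prime_dvd hn (fun {q} hq hqn => hcon q hq hqn)
  apply hpp
  rw [h]
  refine hp.isPrimePow.pow fun h0 => ?_
  rw [h0, pow_zero] at h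
  exact hp.one_lt.ne' (Nat.dvd_one.1 (h ▸ hpn))

/-- A proper divisor of a number which is not a prime power is incomparable, for divisibility,
to some prime power divisor. -/
theorem exists_prime_pow_dvd_not_dvd {n d : ℕ} (hn : n ≠ 0) (hpp : ¬IsPrimePow n) (hd : d ∣ n)
    (hd1 : d ≠ 1) (hdn : d ≠ n) :
    ∃ r k, r.Prime ∧ r ^ k ∣ n ∧ ¬r ^ k ∣ d ∧ ¬d ∣ r ^ k := by
  have hd0 : d ≠ 0 := ne_zero_of_dvd_ne_zero hn hd
  by_cases hdp : IsPrimePow d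
  · obtain ⟨p, a, hp, ha, rfl⟩ := (isPrimePow_nat_iff d).1 hdp
    obtain ⟨q, hq, hqn, hqp⟩ := exists_prime_dvd_ne hn hpp hp ((dvd_pow_self p ha.ne').trans hd)
    refine ⟨q, 1, hq, by simpa using hqn, ?_, ?_⟩
    · rw [pow_one]
      intro h
      exact hqp ((Nat.prime_dvd_prime_iff_eq hq hp).1 (hq.dvd_of_dvd_pow h))
    · rw [pow_one]
      intro h
      exact hqp ((Nat.prime_dvd_prime_iff_eq hp hq).1 ((dvd_pow_self p ha.ne').trans h)).symm
  · have : ¬n ∣ d := fun h => hdn (Nat.dvd_antisymm hd h)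
    rw [Nat.dvd_iff_prime_pow_dvd_dvd] at this
    push Not at this
    obtain ⟨r, k, hr, hrn, hrd⟩ := this
    refine ⟨r, k, hr, hrn, hrd, fun h => hdp ?_⟩
    obtain ⟨m, -, rfl⟩ := (Nat.dvd_prime_pow hr).1 h
    refine hr.isPrimePow.pow ?_
    rintro rfl
    exact hd1 (pow_zero r)

/-- Adjacency in the power graph, with loops: one element is a power of the other. -/
def PowerRel {G : Type*} [Group G] (x y : G) : Prop :=
  x ∈ Subgroup.zpowers y ∨ y ∈ Subgroup.zpowers x

/-- The closed twins of `c` in the power graph. -/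
def powerTwins {G : Type*} [Group G] (c : G) : Set G :=
  {d | ∀ z, PowerRel z d ↔ PowerRel z c}

theorem PowerRel.refl {G : Type*} [Group G] (x : G) : PowerRel x x :=
  Or.inl (Subgroup.mem_zpowers x)

theorem PowerRel.symm {G : Type*} [Group G] {x y : G} (h : PowerRel x y) : PowerRel y x :=
  Or.symm h

theorem powerRel_one {G : Type*} [Group G] (x : G) : PowerRel x 1 :=
  Or.inr (one_mem _)

open Subgroup in
theorem PowerRel.orderOf_dvd {G : Type*} [Group G] {x y : G} (h : PowerRel x y) :
    orderOf x ∣ orderOf y ∨ orderOf y ∣ orderOf x :=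
  h.imp orderOf_dvd_of_mem_zpowers orderOf_dvd_of_mem_zpowers

open Subgroup in
theorem generators_subset_powerTwins {G : Type*} [Group G] (c : G) :
    {g | zpowers g = zpowers c} ⊆ powerTwins c := by
  intro g (hg : zpowers g = zpowers c) z
  have h : ∀ w : G, w ∈ zpowers z ↔ zpowers w ≤ zpowers z := fun w => zpowers_le.symm
  rw [PowerRel, PowerRel, h g, h c, hg]

theorem totient_le_ncard_powerTwins {G : Type*} [Group G] [Finite G] (c : G) :
    (orderOf c).totient ≤ (powerTwins c).ncard := by
  rw [← ncard_generators_zpowers]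
  exact Set.ncard_le_ncard (generators_subset_powerTwins c) (Set.toFinite _)

open Subgroup in
theorem powerRel_of_isPrimePow {G : Type*} [Group G] [Finite G] {c x y : G}
    (hc : IsPrimePow (orderOf c)) (hx : x ∈ zpowers c) (hy : y ∈ zpowers c) : PowerRel x y := by
  obtain ⟨p, k, hp, -, h⟩ := (isPrimePow_nat_iff _).1 hc
  obtain ⟨i, -, hi⟩ := (Nat.dvd_prime_pow hp).1 (h ▸ orderOf_dvd_of_mem_zpowers hx)
  obtain ⟨j, -, hj⟩ := (Nat.dvd_prime_pow hp).1 (h ▸ orderOf_dvd_of_mem_zpowers hy)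
  rcases le_total i j with hij | hij
  · exact Or.inl (mem_zpowers_of_orderOf_dvd hx hy (by rw [hi, hj]; exact pow_dvd_pow p hij))
  · exact Or.inr (mem_zpowers_of_orderOf_dvd hy hx (by rw [hi, hj]; exact pow_dvd_pow p hij))

open Subgroup in
theorem exists_not_powerRel {G : Type*} [Group G] [Finite G] {x y : G}
    (hy : ¬IsPrimePow (orderOf y)) (hxy : x ∈ zpowers y) (hx1 : x ≠ 1) (hyx : y ∉ zpowers x) :
    ∃ z ∈ zpowers y, (∃ r k, r.Prime ∧ orderOf z = r ^ k) ∧ ¬PowerRel z x := by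
  obtain ⟨r, k, hr, hrn, h₁, h₂⟩ := exists_prime_pow_dvd_not_dvd (orderOf_pos y).ne' hy
    (orderOf_dvd_of_mem_zpowers hxy) (by simpa using hx1)
    (fun h => hyx (mem_zpowers_of_orderOf_dvd (mem_zpowers y) hxy h.symm.dvd))
  obtain ⟨z, hz, hzo⟩ := exists_mem_zpowers_orderOf_eq y hrn
  refine ⟨z, hz, ⟨r, k, hr, hzo⟩, fun h => ?_⟩
  rcases h.orderOf_dvd with h | h
  · exact h₁ (hzo ▸ h)
  · exact h₂ (hzo ▸ h)

open Subgroup in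
theorem not_forall_powerRel_imp {G : Type*} [Group G] [Finite G] {x y : G}
    (hy : ¬IsPrimePow (orderOf y)) (hxy : x ∈ zpowers y) (hx1 : x ≠ 1) (hyx : y ∉ zpowers x) :
    ¬∀ z, PowerRel z y → PowerRel z x := by
  obtain ⟨z, hz, -, hzx⟩ := exists_not_powerRel hy hxy hx1 hyx
  exact fun h => hzx (h z (Or.inl hz))

open Subgroup in
/-- Inside a cyclic group of non prime power order, nontrivial twins generate the same subgroup. -/
theorem mem_zpowers_of_powerTwins {G : Type*} [Group G] [Finite G] {x a b : G}
    (hx : ¬IsPrimePow (orderOf x)) (hb : b ∈ zpowers x) (hab : a ∈ zpowers b) (ha1 : a ≠ 1)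
    (htw : ∀ z, PowerRel z b ↔ PowerRel z a) : b ∈ zpowers a := by
  by_contra hba
  by_cases hbp : IsPrimePow (orderOf b)
  swap
  · exact not_forall_powerRel_imp hbp hab ha1 hba fun z => (htw z).1
  obtain ⟨r, j, hr, hj, hbo⟩ := (isPrimePow_nat_iff _).1 hbp
  have hbn := orderOf_dvd_of_mem_zpowers hb
  have habd := orderOf_dvd_of_mem_zpowers hab
  obtain ⟨q, hq, hqn, hqr⟩ := exists_prime_dvd_ne (orderOf_pos x).ne' hx hr
    ((hbo ▸ dvd_pow_self r hj.ne').trans hbn)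
  have hcop : Nat.Coprime (orderOf b) q := by
    rw [← hbo]
    exact Nat.Coprime.pow_left j ((Nat.coprime_primes hr hq).2 hqr.symm)
  have hcopa : Nat.Coprime (orderOf a) q := hcop.coprime_dvd_left habd
  obtain ⟨z, hz, hzo⟩ := exists_mem_zpowers_orderOf_eq x
    (hcopa.mul_dvd_of_dvd_of_dvd (habd.trans hbn) hqn)
  have hax := mem_zpowers_trans hab hb
  have hza : PowerRel z a :=
    Or.inr (mem_zpowers_of_orderOf_dvd hax hz (by rw [hzo]; exact dvd_mul_right _ _))
  rcases ((htw z).2 hza).orderOf_dvd with h | h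
  · rw [hzo] at h
    exact hq.one_lt.ne' (hcop.symm.eq_one_of_dvd ((dvd_mul_left _ _).trans h))
  · rw [hzo] at h
    exact hba (mem_zpowers_of_orderOf_dvd hb hax (hcop.dvd_of_dvd_mul_right h))

open Subgroup in
/-- A nontrivial element properly below an element of non prime power order has only the
generators of its cyclic subgroup as twins. -/
theorem powerTwins_eq_generators {G : Type*} [Group G] [Finite G] {c x : G}
    (hx : ¬IsPrimePow (orderOf x)) (hc1 : c ≠ 1) (hcx : c ∈ zpowers x) (hxc : x ∉ zpowers c) :
    powerTwins c = {g | zpowers g = zpowers c} := by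
  refine subset_antisymm (fun d hd => ?_) (generators_subset_powerTwins c)
  have hd1 : d ≠ 1 := by
    rintro rfl
    exact not_forall_powerRel_imp hx hcx hc1 hxc
      fun z _ => (hd z).1 (powerRel_one z)
  have hdx : d ∈ zpowers x := by
    rcases (hd x).2 (Or.inr hcx) with h | h
    · by_cases hdp : IsPrimePow (orderOf d)
      · exact absurd (hdp.dvd (orderOf_dvd_of_mem_zpowers h) fun h1 => hc1 <| by
          rw [orderOf_eq_one_iff] at h1
          simpa [h1] using hcx) hx
      · exact absurd (fun z => (hd z).1) (not_forall_powerRel_imp hdp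
          (mem_zpowers_trans hcx h) hc1 fun h' => hxc (mem_zpowers_trans h h'))
    · exact h
  rcases (hd d).1 (PowerRel.refl d) with h | h
  · exact zpowers_eq_of_mem h (mem_zpowers_of_powerTwins hx hcx h hd1 fun z => (hd z).symm)
  · exact zpowers_eq_of_mem (mem_zpowers_of_powerTwins hx hdx h hc1 hd) h

open Subgroup in
/-- Twin classes grow along the power order. -/
theorem ncard_powerTwins_le {G : Type*} [Group G] [Finite G] {c x : G}
    (hc1 : c ≠ 1) (hcx : c ∈ zpowers x) (hx : x ∉ powerTwins c) :
    (powerTwins c).ncard ≤ (powerTwins x).ncard := by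
  have hxc : x ∉ zpowers c := fun h =>
    hx (generators_subset_powerTwins c (zpowers_eq_of_mem h hcx))
  refine le_trans ?_ (totient_le_ncard_powerTwins x)
  by_cases hxp : IsPrimePow (orderOf x)
  swap
  · rw [powerTwins_eq_generators hxp hc1 hcx hxc, ncard_generators_zpowers]
    exact Nat.le_of_dvd (Nat.totient_pos.2 (orderOf_pos x))
      (Nat.totient_dvd_of_dvd (orderOf_dvd_of_mem_zpowers hcx))
  obtain ⟨r, k, hr, hk, hxo⟩ := (isPrimePow_nat_iff _).1 hxp
  obtain ⟨m, rfl⟩ : ∃ m, k = m + 1 := ⟨k - 1, by omega⟩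
  obtain ⟨w, hw, hwo⟩ := exists_mem_zpowers_orderOf_eq x (d := r ^ m)
    (hxo ▸ pow_dvd_pow r (Nat.le_succ m))
  have hsub : powerTwins c ⊆ (zpowers w : Set G) := by
    intro d hd
    have hxd : x ∉ zpowers d := by
      intro hxd
      have hcd := mem_zpowers_trans hcx hxd
      by_cases hdp : IsPrimePow (orderOf d)
      · refine hx fun z => ⟨?_, ?_⟩
        · rintro (h | h)
          · exact (hd z).1 (Or.inl (mem_zpowers_trans h hxd))
          · exact Or.inr (mem_zpowers_trans hcx h)
        · intro hz
          rcases (hd z).2 hz with h | h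
          · exact powerRel_of_isPrimePow hdp h hxd
          · exact Or.inr (mem_zpowers_trans hxd h)
      · exact not_forall_powerRel_imp hdp hcd hc1
          (fun h => hxc (mem_zpowers_trans hxd h)) fun z => (hd z).1
    have hdx : d ∈ zpowers x := ((hd x).2 (Or.inr hcx)).resolve_left hxd
    obtain ⟨i, hi, hdo⟩ := (Nat.dvd_prime_pow hr).1 (hxo ▸ orderOf_dvd_of_mem_zpowers hdx)
    have him : i ≠ m + 1 := by
      rintro rfl
      exact hxd (mem_zpowers_of_orderOf_dvd (mem_zpowers x) hdx (by rw [hdo, hxo]))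
    exact mem_zpowers_of_orderOf_dvd hdx hw
      (by rw [hdo, hwo]; exact pow_dvd_pow r (by omega))
  calc (powerTwins c).ncard ≤ (zpowers w : Set G).ncard :=
        Set.ncard_le_ncard hsub (Set.toFinite _)
    _ = r ^ m := by rw [← hwo, ← Nat.card_zpowers]; rfl
    _ ≤ (orderOf x).totient := by
        rw [← hxo, Nat.totient_prime_pow_succ hr]
        exact Nat.le_mul_of_pos_right _ (Nat.sub_pos_of_lt hr.one_lt)

open Subgroup in
/-- Two elements are adjacent in the enhanced power graph if they lie in a common cyclic
subgroup. -/
def CyclicRel {G : Type*} [Group G] (x y : G) : Prop :=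
  ∃ c, x ∈ zpowers c ∧ y ∈ zpowers c

theorem PowerRel.cyclicRel {G : Type*} [Group G] {x y : G} (h : PowerRel x y) :
    CyclicRel x y :=
  h.elim (fun h => ⟨y, h, Subgroup.mem_zpowers y⟩) fun h => ⟨x, Subgroup.mem_zpowers x, h⟩

theorem image_powerTwins {G H : Type*} [Group G] [Group H] (f : G ≃ H)
    (hf : ∀ x y, PowerRel x y ↔ PowerRel (f x) (f y)) (c : G) :
    f '' powerTwins c = powerTwins (f c) := by
  ext w
  obtain ⟨d, rfl⟩ := f.surjective w
  rw [f.injective.mem_set_image]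
  refine ⟨fun h z => ?_, fun h z => ?_⟩
  · obtain ⟨z, rfl⟩ := f.surjective z
    rw [← hf, ← hf]
    exact h z
  · rw [hf, hf]
    exact h (f z)

theorem ncard_powerTwins_map {G H : Type*} [Group G] [Group H] (f : G ≃ H)
    (hf : ∀ x y, PowerRel x y ↔ PowerRel (f x) (f y)) (c : G) :
    (powerTwins (f c)).ncard = (powerTwins c).ncard := by
  rw [← image_powerTwins f hf, Set.ncard_image_of_injective _ f.injective]

open Subgroup in
/-- A power graph isomorphism fixing the identity cannot turn an upper bound of two incomparable
elements into a lower bound. -/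
theorem map_mem_zpowers_of_not_powerRel {G H : Type*} [Group G] [Finite G] [Group H] [Finite H]
    (f : G ≃ H) (hf1 : f 1 = 1) (hf : ∀ x y, PowerRel x y ↔ PowerRel (f x) (f y)) {c x y : G}
    (hx : x ∈ zpowers c) (hy : y ∈ zpowers c) (hxy : ¬PowerRel x y) :
    f x ∈ zpowers (f c) := by
  by_contra hcon
  have hup : ∀ {u v : G}, f c ∈ zpowers (f u) → v ∈ zpowers c → ¬PowerRel u v →
      f c ∈ zpowers (f v) := by
    intro u v hu hv huv
    refine ((hf v c).1 (Or.inl hv)).resolve_left fun h => huv ?_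
    exact (hf u v).2 (Or.inr (mem_zpowers_trans h hu))
  have hxu : f c ∈ zpowers (f x) := ((hf x c).1 (Or.inl hx)).resolve_left hcon
  have hcp : ¬IsPrimePow (orderOf c) := fun h => hxy (powerRel_of_isPrimePow h hx hy)
  have hx1 : x ≠ 1 := by
    rintro rfl
    exact hxy (powerRel_one y).symm
  have hc1 : c ≠ 1 := by
    rintro rfl
    exact hx1 (by simpa using hx)
  have hcx : c ∉ zpowers x := fun h => hxy (Or.inr (mem_zpowers_trans hy h))
  obtain ⟨u, r, hr, hu, huo, hut⟩ : ∃ u r, r.Prime ∧ u ∈ zpowers c ∧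
      (∃ k, k ≠ 0 ∧ orderOf u = r ^ k) ∧ f c ∈ zpowers (f u) := by
    obtain ⟨z, hz, ⟨r, k, hr, hzo⟩, hzx⟩ := exists_not_powerRel hcp hx hx1 hcx
    refine ⟨z, r, hr, hz, ⟨k, ?_, hzo⟩, hup hxu hz fun h => hzx h.symm⟩
    rintro rfl
    rw [pow_zero, orderOf_eq_one_iff] at hzo
    exact hzx (hzo ▸ (powerRel_one x).symm)
  obtain ⟨k, hk, huo⟩ := huo
  have hrc : r ∣ orderOf c :=
    (huo ▸ dvd_pow_self r hk).trans (orderOf_dvd_of_mem_zpowers hu)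
  obtain ⟨q, hq, hqc, hqr⟩ := exists_prime_dvd_ne (orderOf_pos c).ne' hcp hr hrc
  obtain ⟨w, hw, hwo⟩ := exists_mem_zpowers_orderOf_eq c hqc
  obtain ⟨v, hv, hvo⟩ := exists_mem_zpowers_orderOf_eq c hrc
  have hinc : ∀ {a : G} {i : ℕ}, i ≠ 0 → orderOf a = r ^ i → ¬PowerRel a w := by
    intro a i hi ha h
    rcases h.orderOf_dvd with h | h <;> rw [ha, hwo] at h
    · exact hqr ((Nat.prime_dvd_prime_iff_eq hr hq).1 ((dvd_pow_self r hi).trans h)).symm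
    · exact hqr ((Nat.prime_dvd_prime_iff_eq hq hr).1 (hq.dvd_of_dvd_pow h))
  have hwt := hup hut hw (hinc hk huo)
  have hvt := hup hwt hv fun h => hinc one_ne_zero (by rw [hvo, pow_one]) h.symm
  have hbound : ∀ {a : G} {p : ℕ}, p.Prime → a ∈ zpowers c → orderOf a = p →
      f c ∈ zpowers (f a) → (orderOf c).totient ≤ p - 1 := by
    intro a p hp ha hao hat
    have ha1 : a ≠ 1 := by
      rintro rfl
      exact hp.one_lt.ne (by rw [← hao, orderOf_one])
    have hca : c ∉ zpowers a := fun h => hcp <|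
      hp.isPrimePow.dvd (hao ▸ orderOf_dvd_of_mem_zpowers h) (by simpa using hc1)
    have hatw : f a ∉ powerTwins (f c) := by
      rw [← image_powerTwins f hf, f.injective.mem_set_image]
      intro h
      exact not_forall_powerRel_imp hcp ha ha1 hca fun z => (h z).2
    have hfc1 : f c ≠ 1 := fun h => hc1 (f.injective (h.trans hf1.symm))
    have h := ncard_powerTwins_le hfc1 hat hatw
    rw [ncard_powerTwins_map f hf, ncard_powerTwins_map f hf,
      powerTwins_eq_generators hcp ha1 ha hca, ncard_generators_zpowers, hao,
      Nat.totient_prime hp] at h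
    exact (totient_le_ncard_powerTwins c).trans h
  have h₁ := hbound hr hv hvo hvt
  have h₂ := hbound hq hw hwo hwt
  have hcop : r.Coprime q := (Nat.coprime_primes hr hq).2 hqr.symm
  have h₃ : (r - 1) * (q - 1) ≤ (orderOf c).totient := by
    rw [← Nat.totient_prime hr, ← Nat.totient_prime hq, ← Nat.totient_mul hcop]
    exact Nat.le_of_dvd (Nat.totient_pos.2 (orderOf_pos c))
      (Nat.totient_dvd_of_dvd (hcop.mul_dvd_of_dvd_of_dvd hrc hqc))
  obtain ⟨a, rfl⟩ : ∃ a, r = a + 2 := ⟨r - 2, by have := hr.two_le; omega⟩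
  obtain ⟨b, rfl⟩ : ∃ b, q = b + 2 := ⟨q - 2, by have := hq.two_le; omega⟩
  have h₄ : (a + 1) * (b + 1) ≤ a + 1 := h₃.trans h₁
  have h₅ : (a + 1) * (b + 1) ≤ b + 1 := h₃.trans h₂
  have hb : b = 0 := by nlinarith
  have ha : a = 0 := by nlinarith
  exact hqr (by rw [ha, hb])

theorem CyclicRel.map {G H : Type*} [Group G] [Finite G] [Group H] [Finite H]
    (f : G ≃ H) (hf1 : f 1 = 1) (hf : ∀ x y, PowerRel x y ↔ PowerRel (f x) (f y)) {x y : G}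
    (h : CyclicRel x y) : CyclicRel (f x) (f y) := by
  by_cases hxy : PowerRel x y
  · exact ((hf x y).1 hxy).cyclicRel
  · obtain ⟨c, hx, hy⟩ := h
    exact ⟨f c, map_mem_zpowers_of_not_powerRel f hf1 hf hx hy hxy,
      map_mem_zpowers_of_not_powerRel f hf1 hf hy hx fun h => hxy h.symm⟩

theorem cyclicRel_iff_of_powerRel_iff {G H : Type*} [Group G] [Finite G] [Group H] [Finite H]
    (f : G ≃ H) (hf1 : f 1 = 1) (hf : ∀ x y, PowerRel x y ↔ PowerRel (f x) (f y)) (x y : G) :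
    CyclicRel x y ↔ CyclicRel (f x) (f y) := by
  refine ⟨CyclicRel.map f hf1 hf, fun h => ?_⟩
  simpa using h.map f.symm (by rw [f.symm_apply_eq, hf1])
    fun a b => by rw [hf, f.apply_symm_apply, f.apply_symm_apply]

/-- Elements whose neighbourhood in the enhanced power graph is a clique. -/
def IsCyclicSimplicial {G : Type*} [Group G] (x : G) : Prop :=
  ∀ y z, CyclicRel x y → CyclicRel x z → CyclicRel y z

theorem CyclicRel.symm {G : Type*} [Group G] {x y : G} (h : CyclicRel x y) : CyclicRel y x :=
  h.imp fun _ h => h.symm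

open Subgroup in
/-- Every element lies in a maximal cyclic subgroup. -/
theorem exists_maximal_zpowers {G : Type*} [Group G] [Finite G] (x : G) :
    ∃ c, x ∈ zpowers c ∧ ∀ y, CyclicRel c y ↔ y ∈ zpowers c := by
  obtain ⟨c, hxc, hc⟩ := Set.exists_max_image {c | x ∈ zpowers c} orderOf (Set.toFinite _)
    ⟨x, mem_zpowers x⟩
  refine ⟨c, hxc, fun y => ⟨?_, fun h => ⟨c, mem_zpowers c, h⟩⟩⟩
  rintro ⟨d, hcd, hyd⟩
  have hdc := hc d (mem_zpowers_trans hxc hcd)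
  have heq := Nat.dvd_antisymm (orderOf_dvd_of_mem_zpowers hcd)
    (Nat.le_antisymm hdc (Nat.le_of_dvd (orderOf_pos d) (orderOf_dvd_of_mem_zpowers hcd))).dvd
  exact mem_zpowers_trans hyd (mem_zpowers_of_orderOf_dvd (mem_zpowers d) hcd heq.symm.dvd)

theorem exists_isCyclicSimplicial {G : Type*} [Group G] [Finite G] (x : G) :
    ∃ c, IsCyclicSimplicial c ∧ CyclicRel c x := by
  obtain ⟨c, hxc, hc⟩ := exists_maximal_zpowers x
  exact ⟨c, fun y z hy hz => ⟨c, (hc y).1 hy, (hc z).1 hz⟩, (hc x).2 hxc⟩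

open Subgroup in
theorem IsCyclicSimplicial.exists_zpowers {G : Type*} [Group G] [Finite G] {x : G}
    (hx : IsCyclicSimplicial x) : ∃ c, ∀ y, CyclicRel x y ↔ y ∈ zpowers c := by
  obtain ⟨c, hxc, hc⟩ := exists_maximal_zpowers x
  refine ⟨c, fun y => ⟨fun h => ?_, fun h => ⟨c, hxc, h⟩⟩⟩
  exact (hc y).1 (hx c y ⟨c, hxc, mem_zpowers c⟩ h)

open Subgroup in
theorem exists_zpowers_forall_cyclicRel {G : Type*} [Group G] [Finite G] {t : Set G}
    (ht : t.Nonempty) (hs : ∀ x ∈ t, IsCyclicSimplicial x) :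
    ∃ c : G, {g | ∀ x ∈ t, CyclicRel x g} = (zpowers c : Set G) := by
  choose! c hc using fun x hx => (hs x hx).exists_zpowers
  obtain ⟨x₀, hx₀⟩ := ht
  have hle : (⨅ x ∈ t, zpowers (c x)) ≤ zpowers (c x₀) := iInf₂_le x₀ hx₀
  have hcyc : IsCyclic (⨅ x ∈ t, zpowers (c x) : Subgroup G) :=
    isCyclic_of_injective (inclusion hle) (inclusion_injective hle)
  obtain ⟨g, hg⟩ := (Subgroup.isCyclic_iff_exists_zpowers_eq_top _).1 hcyc
  refine ⟨g, ?_⟩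
  rw [hg]
  ext y
  simp only [Set.mem_ofPred_eq, SetLike.mem_coe, mem_iInf]
  exact forall₂_congr fun x hx => hc x hx y

open Subgroup in
theorem card_orderOf_eq_of_cyclicRel_iff {G H : Type*} [Group G] [Finite G] [Group H] [Finite H]
    (f : G ≃ H) (hf : ∀ x y, CyclicRel x y ↔ CyclicRel (f x) (f y)) (n : ℕ) :
    Nat.card {x : G // orderOf x = n} = Nat.card {x : H // orderOf x = n} := by
  classical
  have := Fintype.ofFinite G
  have := Fintype.ofFinite H
  have hsimp : ∀ x, IsCyclicSimplicial x ↔ IsCyclicSimplicial (f x) := by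
    intro x
    simp only [IsCyclicSimplicial, f.surjective.forall, ← hf]
  let s : Finset G := Finset.univ.filter IsCyclicSimplicial
  let S : G → Finset G := fun x => Finset.univ.filter fun g => CyclicRel x g ∧ orderOf g = n
  let T : G → Finset H := fun x => Finset.univ.filter fun g => CyclicRel (f x) g ∧ orderOf g = n
  have hS : s.biUnion S = Finset.univ.filter fun g => orderOf g = n := by
    ext g
    obtain ⟨c, hc, hcg⟩ := exists_isCyclicSimplicial g
    simp only [s, S, Finset.mem_biUnion, Finset.mem_filter, Finset.mem_univ, true_and]
    exact ⟨fun ⟨_, _, _, h⟩ => h, fun h => ⟨c, hc, hcg, h⟩⟩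
  have hT : s.biUnion T = Finset.univ.filter fun g => orderOf g = n := by
    ext g
    obtain ⟨c, hc, hcg⟩ := exists_isCyclicSimplicial g
    obtain ⟨c, rfl⟩ := f.surjective c
    simp only [s, T, Finset.mem_biUnion, Finset.mem_filter, Finset.mem_univ, true_and]
    exact ⟨fun ⟨_, _, _, h⟩ => h, fun h => ⟨c, (hsimp c).2 hc, hcg, h⟩⟩
  rw [Nat.card_eq_fintype_card, Nat.card_eq_fintype_card, Fintype.card_subtype,
    Fintype.card_subtype, ← hS, ← hT]
  zify
  rw [Finset.inclusion_exclusion_card_biUnion, Finset.inclusion_exclusion_card_biUnion]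
  refine Finset.sum_congr rfl fun t _ => ?_
  obtain ⟨t, ht⟩ := t
  obtain ⟨hts, htn⟩ := Finset.mem_filter.1 ht
  have hts : ∀ x ∈ t, IsCyclicSimplicial x := fun x hx =>
    (Finset.mem_filter.1 (Finset.mem_powerset.1 hts hx)).2
  obtain ⟨c, hc⟩ := exists_zpowers_forall_cyclicRel (t := (t : Set G)) htn hts
  obtain ⟨d, hd⟩ := exists_zpowers_forall_cyclicRel (t := f '' (t : Set G)) (htn.to_set.image f)
    (by rintro _ ⟨x, hx, rfl⟩; exact (hsimp x).1 (hts x hx))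
  have himage : f '' (zpowers c : Set G) = zpowers d := by
    rw [← hc, ← hd]
    ext y
    obtain ⟨y, rfl⟩ := f.surjective y
    rw [f.injective.mem_set_image]
    simp only [Set.mem_ofPred_eq, Set.forall_mem_image, hf]
  have hcd : orderOf c = orderOf d := by
    rw [← Nat.card_zpowers, ← Nat.card_zpowers]
    change (zpowers c : Set G).ncard = (zpowers d : Set H).ncard
    rw [← himage, Set.ncard_image_of_injective _ f.injective]
  congr 2
  have h₁ : ((t.inf' htn S : Finset G) : Set G) = {g | g ∈ zpowers c ∧ orderOf g = n} := by
    ext g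
    have := Set.ext_iff.1 hc g
    simp only [Set.mem_ofPred_eq, SetLike.mem_coe] at this
    rw [Set.mem_ofPred_eq, ← this, Finset.mem_coe, Finset.mem_inf']
    simp only [S, Finset.mem_filter, Finset.mem_univ, true_and]
    obtain ⟨x₀, hx₀⟩ := htn
    exact ⟨fun h => ⟨fun x hx => (h x hx).1, (h x₀ hx₀).2⟩, fun h x hx => ⟨h.1 x hx, h.2⟩⟩
  have h₂ : ((t.inf' htn T : Finset H) : Set H) = {g | g ∈ zpowers d ∧ orderOf g = n} := by
    ext g
    have := Set.ext_iff.1 hd g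
    simp only [Set.mem_ofPred_eq, SetLike.mem_coe, Set.forall_mem_image] at this
    rw [Set.mem_ofPred_eq, ← this, Finset.mem_coe, Finset.mem_inf']
    simp only [T, Finset.mem_filter, Finset.mem_univ, true_and]
    obtain ⟨x₀, hx₀⟩ := htn
    exact ⟨fun h => ⟨fun x hx => (h x hx).1, (h x₀ hx₀).2⟩, fun h x hx => ⟨h.1 hx, h.2⟩⟩
  rw [← Set.ncard_coe_finset, ← Set.ncard_coe_finset, h₁, h₂]
  exact ncard_orderOf_eq_of_zpowers hcd n

theorem independent_singleton {G : Type*} [Group G] (x : G) :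
    Independent ({x} : Set G) ↔ x ≠ 1 := by
  simp [Independent]

theorem independent_pair {G : Type*} [Group G] {x y : G} (hxy : x ≠ y) :
    Independent ({x, y} : Set G) ↔ ¬PowerRel x y := by
  have h₁ : ({x, y} : Set G) \ {x} = {y} := by
    ext z; simp only [Set.mem_sdiff, Set.mem_insert_iff, Set.mem_singleton_iff]; grind
  have h₂ : ({x, y} : Set G) \ {y} = {x} := by
    ext z; simp only [Set.mem_sdiff, Set.mem_insert_iff, Set.mem_singleton_iff]; grind
  simp only [Independent, PowerRel, Set.forall_mem_insert, Set.mem_singleton_iff, forall_eq, h₁, h₂,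
    ← Subgroup.zpowers_eq_closure, not_or]

open Subgroup in
theorem dgen_le_one_iff {G : Type*} [Group G] [Finite G] (H : Subgroup G) :
    dgen H ≤ 1 ↔ ∃ c, H = zpowers c := by
  constructor
  · intro h
    have hne : {n : ℕ | ∃ S : Set G, S.Finite ∧ S ⊆ (H : Set G) ∧ closure S = H ∧
        S.ncard = n}.Nonempty :=
      ⟨_, (H : Set G), Set.toFinite _, subset_rfl, closure_eq H, rfl⟩
    obtain ⟨S, hS, -, hcl, hcard⟩ := Nat.sInf_mem hne
    have hS1 : S.ncard ≤ 1 := hcard ▸ h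
    obtain ⟨c, hc⟩ : ∃ c, S ⊆ {c} := by
      rcases S.eq_empty_or_nonempty with rfl | ⟨c, hc⟩
      · exact ⟨1, Set.empty_subset _⟩
      · exact ⟨c, fun a ha => (Set.ncard_le_one hS).1 hS1 a ha c hc⟩
    rcases Set.subset_singleton_iff_eq.1 hc with h | h
    · exact ⟨1, by rw [← hcl, h, Subgroup.closure_empty, zpowers_one_eq_bot]⟩
    · exact ⟨c, by rw [← hcl, h, zpowers_eq_closure]⟩
  · rintro ⟨c, rfl⟩
    exact Nat.sInf_le ⟨{c}, Set.finite_singleton c, by simp, (zpowers_eq_closure c).symm,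
      Set.ncard_singleton c⟩

theorem stronglyIndependent_pair {G : Type*} [Group G] [Finite G] {x y : G} (hxy : x ≠ y) :
    StronglyIndependent ({x, y} : Set G) ↔ ¬CyclicRel x y := by
  rw [StronglyIndependent, Set.ncard_pair hxy]
  constructor
  · rintro h ⟨c, hx, hy⟩
    have := h (Subgroup.zpowers c) (Set.insert_subset hx (Set.singleton_subset_iff.2 hy))
    have := (dgen_le_one_iff (Subgroup.zpowers c)).2 ⟨c, rfl⟩
    omega
  · intro h H hH
    by_contra hlt
    obtain ⟨c, rfl⟩ := (dgen_le_one_iff H).1 (by omega)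
    exact h ⟨c, hH (by simp), hH (by simp)⟩

theorem indep_iso_preserves_order_counts
    (G₁ G₂ : Type) [Group G₁] [Finite G₁] [Group G₂] [Finite G₂]
    (h : (∃ φ : G₁ ≃ G₂, ∀ X : Set G₁, Independent X ↔ Independent (φ '' X)) ∨
         (∃ φ : G₁ ≃ G₂, ∀ X : Set G₁,
            StronglyIndependent X ↔ StronglyIndependent (φ '' X))) :
    ∀ n : ℕ, 0 < n →
      Nat.card {x : G₁ // orderOf x = n} = Nat.card {x : G₂ // orderOf x = n} := by
  intro n _
  rcases h with ⟨φ, hφ⟩ | ⟨φ, hφ⟩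
  · have h1 : φ 1 = 1 := by
      have h := hφ {1}
      rw [Set.image_singleton, independent_singleton, independent_singleton] at h
      simpa using h
    refine card_orderOf_eq_of_cyclicRel_iff φ (cyclicRel_iff_of_powerRel_iff φ h1 ?_) n
    intro x y
    by_cases hxy : x = y
    · subst hxy
      exact iff_of_true (PowerRel.refl _) (PowerRel.refl _)
    · have h := hφ {x, y}
      rw [Set.image_pair, independent_pair hxy, independent_pair (φ.injective.ne hxy)] at h
      exact not_iff_not.1 h
  · refine card_orderOf_eq_of_cyclicRel_iff φ (fun x y => ?_) n
    by_cases hxy : x = y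
    · subst hxy
      exact iff_of_true (PowerRel.refl _).cyclicRel (PowerRel.refl _).cyclicRel
    · have h := hφ {x, y}
      rw [Set.image_pair, stronglyIndependent_pair hxy,
        stronglyIndependent_pair (φ.injective.ne hxy)] at h
      exact not_iff_not.1 h
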